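/- arXiv:1305.6008 — 2 statements merged into one kernel-verified Lean document; each statement's English description precedes it below -/
import Mathlib

section
/- Existence of optimal superhedging strategies (Theorem 2.2): Assume NA(𝒫) holds and let f be a random variable. Then π(f) := inf{x ∈ ℝ : ∃H ∈ ℋ with x + (H·S)_T ≥ f 𝒫-q.s.} > −∞, and there exists H ∈ ℋ such that π(f) + (H·S)_T ≥ f 𝒫-q.s. (in particular the infimum, when finite, is attained). -/
open MeasureTheory Set Filter Topology
open scoped ENNReal NNReal

noncomputable section

namespace BN

/-- The universal completion of the ambient measurable structure on `α`:
a set is measurable iff it is null-measurable for every probability measure. -/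
def univComp (α : Type*) [MeasurableSpace α] : MeasurableSpace α where
  MeasurableSet' s := ∀ μ : Measure α, IsProbabilityMeasure μ → NullMeasurableSet s μ
  measurableSet_empty := fun _ _ => MeasurableSet.empty.nullMeasurableSet
  measurableSet_compl := fun _ hs μ hμ => (hs μ hμ).compl
  measurableSet_iUnion := fun _ hf μ hμ => NullMeasurableSet.iUnion fun i => hf i μ hμ

/-- `N` is `PP`-polar: it is contained in an `m`-measurable set which is null under
every `P ∈ PP`. -/
def IsPolar {α : Type*} [MeasurableSpace α] (PP : Set (Measure α)) (m : MeasurableSpace α)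
    (N : Set α) : Prop :=
  ∃ A : Set α, MeasurableSet[m] A ∧ N ⊆ A ∧ ∀ P ∈ PP, P A = 0

/-- A property holds `PP`-quasi surely if its complement is `PP`-polar. -/
def QuasiSure {α : Type*} [mα : MeasurableSpace α] (PP : Set (Measure α))
    (m : MeasurableSpace α) (p : α → Prop) : Prop :=
  @IsPolar α mα PP m {ω | ¬ p ω}

/-- Expectation of a real random variable, with the convention
`E[f] = E[f⁺] - E[f⁻]` and `∞ - ∞ = -∞` (which holds in `EReal`). -/
def expec {α : Type*} [MeasurableSpace α] (Q : Measure α) (f : α → ℝ) : EReal :=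
  ((∫⁻ x, ENNReal.ofReal (f x) ∂Q : ℝ≥0∞) : EReal)
    - ((∫⁻ x, ENNReal.ofReal (-f x) ∂Q : ℝ≥0∞) : EReal)

/-- Positive part of an extended real, valued in `ℝ≥0∞`. -/
def posE (x : EReal) : ℝ≥0∞ := if x = ⊤ then ⊤ else ENNReal.ofReal x.toReal

/-- Expectation of an extended-real random variable, with the convention
`E[f] = E[f⁺] - E[f⁻]` and `∞ - ∞ = -∞`. -/
def eexpec {α : Type*} [MeasurableSpace α] (Q : Measure α) (f : α → EReal) : EReal :=
  ((∫⁻ x, posE (f x) ∂Q : ℝ≥0∞) : EReal) - ((∫⁻ x, posE (-(f x)) ∂Q : ℝ≥0∞) : EReal)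

/-- A real-valued function is upper semianalytic if all its strict superlevel sets
are analytic. -/
def UpperSemianalytic {α : Type*} [TopologicalSpace α] (f : α → ℝ) : Prop :=
  ∀ c : ℝ, AnalyticSet {x | c < f x}

/-- An extended-real-valued function is upper semianalytic if all its strict
superlevel sets `{f > c}`, `c ∈ ℝ`, are analytic. -/
def UpperSemianalyticE {α : Type*} [TopologicalSpace α] (f : α → EReal) : Prop :=
  ∀ c : ℝ, AnalyticSet {x | (c : EReal) < f x}

/-- Convexity of a set of probability measures. -/
def ConvexPM {α : Type*} [MeasurableSpace α] (C : Set (ProbabilityMeasure α)) : Prop :=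
  ∀ μ ∈ C, ∀ ν ∈ C, ∀ a b : ℝ≥0∞, a + b = 1 →
    ∀ ξ : ProbabilityMeasure α, (ξ : Measure α) = a • (μ : Measure α) + b • (ν : Measure α) →
      ξ ∈ C

/-! ### The general (non-Polish) setting of Section 2 -/

section General

variable {Ω : Type*} [MeasurableSpace Ω]

/-- Predictability of a trading strategy `H` with respect to a filtration `F`:
the holding `H (u+1)` over the period `(u, u+1]` is `F u`-measurable. -/
def PredictableF (F : ℕ → MeasurableSpace Ω) (T d : ℕ) (H : ℕ → Ω → Fin d → ℝ) : Prop :=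
  ∀ u : ℕ, u < T → Measurable[F u] (H (u + 1))

/-- The final gain `(H · S)_T` from trading `H` in the stocks `S`. -/
def gainF {d : ℕ} (S : ℕ → Ω → Fin d → ℝ) (H : ℕ → Ω → Fin d → ℝ) (T : ℕ) (ω : Ω) : ℝ :=
  ∑ u : Fin T, ∑ i : Fin d, H (u + 1) ω i * (S (u + 1) ω i - S u ω i)

/-- The no-arbitrage condition `NA(PP)` (no options). -/
def NAF (F : ℕ → MeasurableSpace Ω) (T d : ℕ) (S : ℕ → Ω → Fin d → ℝ)
    (PP : Set (Measure Ω)) : Prop :=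
  ∀ H : ℕ → Ω → Fin d → ℝ, PredictableF F T d H →
    QuasiSure PP ‹MeasurableSpace Ω› (fun ω => 0 ≤ gainF S H T ω) →
      QuasiSure PP ‹MeasurableSpace Ω› (fun ω => gainF S H T ω = 0)

/-- The cone `𝒞` of claims superreplicable from zero initial capital. -/
def Cset (F : ℕ → MeasurableSpace Ω) (T d : ℕ) (S : ℕ → Ω → Fin d → ℝ) : Set (Ω → ℝ) :=
  {W | ∃ H : ℕ → Ω → Fin d → ℝ, PredictableF F T d H ∧
    ∃ K : Ω → ℝ, Measurable K ∧ (∀ ω, 0 ≤ K ω) ∧ ∀ ω, W ω = gainF S H T ω - K ω}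

/-- The superhedging price (no options), with values in `EReal` (`inf ∅ = +∞`). -/
def superPriceF (F : ℕ → MeasurableSpace Ω) (T d : ℕ) (S : ℕ → Ω → Fin d → ℝ)
    (PP : Set (Measure Ω)) (f : Ω → ℝ) : EReal :=
  sInf ((fun x : ℝ => (x : EReal)) ''
    {x : ℝ | ∃ H : ℕ → Ω → Fin d → ℝ, PredictableF F T d H ∧
      QuasiSure PP ‹MeasurableSpace Ω› (fun ω => f ω ≤ x + gainF S H T ω)})

end General

/-! ### The one-period setting of Section 3 -/

section OnePeriod

variable {Ω : Type*} [MeasurableSpace Ω] {d : ℕ}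

/-- One-period no-arbitrage condition `NA(PP)` for the increment `ΔS`. -/
def NA1 (PP : Set (Measure Ω)) (ΔS : Ω → Fin d → ℝ) : Prop :=
  ∀ y : Fin d → ℝ,
    QuasiSure PP ‹MeasurableSpace Ω› (fun ω => 0 ≤ ∑ i, y i * ΔS ω i) →
      QuasiSure PP ‹MeasurableSpace Ω› (fun ω => ∑ i, y i * ΔS ω i = 0)

/-- The martingale measures dominated by `PP` in the one-period market:
`𝒬 = {Q : Q ⋘ 𝒫, E_Q[ΔS] = 0}`. -/
def Q1set (PP : Set (Measure Ω)) (ΔS : Ω → Fin d → ℝ) : Set (Measure Ω) :=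
  {Q | IsProbabilityMeasure Q ∧ (∃ P ∈ PP, Q ≪ P) ∧
    ∀ i, expec Q (fun ω => ΔS ω i) = 0}

/-- One-period superhedging price, with values in `EReal` (`inf ∅ = +∞`). -/
def superPrice1 (PP : Set (Measure Ω)) (ΔS : Ω → Fin d → ℝ) (f : Ω → ℝ) : EReal :=
  sInf ((fun x : ℝ => (x : EReal)) ''
    {x : ℝ | ∃ H : Fin d → ℝ,
      QuasiSure PP ‹MeasurableSpace Ω› (fun ω => f ω ≤ x + ∑ i, H i * ΔS ω i)})

end OnePeriod

/-! ### The Polish multi-period setting -/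

section Polish

variable (Ω₁ : Type) [MeasurableSpace Ω₁]

/-- Restriction of a path up to time `t`. -/
def restr {T : ℕ} (t : ℕ) (h : t ≤ T) (ω : Fin T → Ω₁) : Fin t → Ω₁ :=
  fun i => ω (Fin.castLE h i)

/-- Universally measurable predictability: `H u` (the holding over `(u, u+1]`)
is a universally measurable function of the first `u` coordinates. -/
def Pred (d : ℕ) (H : (u : ℕ) → (Fin u → Ω₁) → Fin d → ℝ) : Prop :=
  ∀ u : ℕ, @Measurable _ _ (univComp (Fin u → Ω₁)) _ (H u)

/-- The gain `(H · S)_t = ∑_{u=1}^t H_u (S_u - S_{u-1})` up to time `t ≤ T`. -/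
def gain {T d : ℕ} (S : (t : ℕ) → (Fin t → Ω₁) → Fin d → ℝ)
    (H : (u : ℕ) → (Fin u → Ω₁) → Fin d → ℝ) (t : ℕ) (h : t ≤ T) (ω : Fin T → Ω₁) : ℝ :=
  ∑ u : Fin t, ∑ i : Fin d,
    H u (restr Ω₁ u (u.2.le.trans h) ω) i *
      (S (u + 1) (restr Ω₁ (u + 1) (Nat.succ_le_of_lt (u.2.trans_le h)) ω) i
        - S u (restr Ω₁ u (u.2.le.trans h) ω) i)

variable [TopologicalSpace Ω₁] [OpensMeasurableSpace Ω₁]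

/-- The set `PP = {P₀ ⊗ ⋯ ⊗ P_{t-1}}` of measures built from universally
measurable selectors of the one-step collections `𝒫_s(·)`. -/
def MeasFam (Pt : (t : ℕ) → (Fin t → Ω₁) → Set (ProbabilityMeasure Ω₁)) :
    (t : ℕ) → Set (Measure (Fin t → Ω₁))
  | 0 => {μ | μ = Measure.dirac Fin.elim0}
  | (t + 1) => {μ | ∃ ν ∈ MeasFam Pt t, ∃ κ : (Fin t → Ω₁) → ProbabilityMeasure Ω₁,
      @Measurable _ _ (univComp (Fin t → Ω₁)) (borel (ProbabilityMeasure Ω₁)) κ ∧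
      (∀ ω, κ ω ∈ Pt t ω) ∧
      μ = ν.bind (fun ω => Measure.map (Fin.snoc ω) (κ ω : Measure Ω₁))}

/-- The σ-field `ℱ_t` on `Ω = Ω₁^T`: the comap under the restriction map of the
universal completion of the Borel σ-field of `Ω₁^t`. -/
def filtr (T : ℕ) (t : ℕ) (h : t ≤ T) : MeasurableSpace (Fin T → Ω₁) :=
  MeasurableSpace.comap (restr Ω₁ t h) (univComp (Fin t → Ω₁))

/-- `S` is a `Q`-martingale with respect to the filtration `(ℱ_t)`. -/
def IsMartMeas {T d : ℕ} (S : (t : ℕ) → (Fin t → Ω₁) → Fin d → ℝ)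
    (Q : Measure (Fin T → Ω₁)) : Prop :=
  (∀ (t : ℕ) (h : t ≤ T) (i : Fin d), Integrable (fun ω => S t (restr Ω₁ t h ω) i) Q) ∧
  (∀ (t : ℕ) (h : t + 1 ≤ T) (i : Fin d) (A : Set (Fin T → Ω₁)),
    MeasurableSet[filtr Ω₁ T t ((Nat.le_succ t).trans h)] A →
      ∫ ω in A, S (t + 1) (restr Ω₁ (t + 1) h ω) i ∂Q
        = ∫ ω in A, S t (restr Ω₁ t ((Nat.le_succ t).trans h) ω) i ∂Q)

/-- The martingale measures `Q ⋘ PP` consistent with the option prices: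
`𝒬 = {Q ⋘ PP : S is a Q-martingale, E_Q[gⁱ] = 0}`. -/
def QSet {T d e : ℕ} (PP : Set (Measure (Fin T → Ω₁)))
    (S : (t : ℕ) → (Fin t → Ω₁) → Fin d → ℝ) (g : Fin e → (Fin T → Ω₁) → ℝ) :
    Set (Measure (Fin T → Ω₁)) :=
  {Q | IsProbabilityMeasure Q ∧ (∃ P ∈ PP, Q ≪ P) ∧ IsMartMeas Ω₁ S Q ∧
    ∀ i : Fin e, expec Q (g i) = 0}

/-- The no-arbitrage condition `NA(PP)` with semistatic trading in the stocks `S`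
and the options `g`. -/
def NA {T d e : ℕ} (PP : Set (Measure (Fin T → Ω₁)))
    (S : (t : ℕ) → (Fin t → Ω₁) → Fin d → ℝ) (g : Fin e → (Fin T → Ω₁) → ℝ) : Prop :=
  ∀ H : (u : ℕ) → (Fin u → Ω₁) → Fin d → ℝ, Pred Ω₁ d H → ∀ h : Fin e → ℝ,
    QuasiSure PP (univComp (Fin T → Ω₁))
      (fun ω => 0 ≤ gain Ω₁ S H T le_rfl ω + ∑ i, h i * g i ω) →
    QuasiSure PP (univComp (Fin T → Ω₁))
      (fun ω => gain Ω₁ S H T le_rfl ω + ∑ i, h i * g i ω = 0)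

/-- The minimal semistatic superhedging price, valued in `EReal` (`inf ∅ = +∞`). -/
def superPrice {T d e : ℕ} (PP : Set (Measure (Fin T → Ω₁)))
    (S : (t : ℕ) → (Fin t → Ω₁) → Fin d → ℝ) (g : Fin e → (Fin T → Ω₁) → ℝ)
    (f : (Fin T → Ω₁) → ℝ) : EReal :=
  sInf ((fun x : ℝ => (x : EReal)) ''
    {x : ℝ | ∃ H : (u : ℕ) → (Fin u → Ω₁) → Fin d → ℝ, ∃ h : Fin e → ℝ, Pred Ω₁ d H ∧
      QuasiSure PP (univComp (Fin T → Ω₁))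
        (fun ω => f ω ≤ x + gain Ω₁ S H T le_rfl ω + ∑ i, h i * g i ω)})

/-- `f` is replicable by semistatic trading. -/
def Replicable {T d e : ℕ} (PP : Set (Measure (Fin T → Ω₁)))
    (S : (t : ℕ) → (Fin t → Ω₁) → Fin d → ℝ) (g : Fin e → (Fin T → Ω₁) → ℝ)
    (f : (Fin T → Ω₁) → ℝ) : Prop :=
  ∃ x : ℝ, ∃ H : (u : ℕ) → (Fin u → Ω₁) → Fin d → ℝ, ∃ h : Fin e → ℝ, Pred Ω₁ d H ∧
    QuasiSure PP (univComp (Fin T → Ω₁))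
      (fun ω => x + gain Ω₁ S H T le_rfl ω + ∑ i, h i * g i ω = f ω)

/-- The one-period increment `ΔS_{t+1}(ω, ·)` of the stock, given history `ω ∈ Ω_t`. -/
def incr {d : ℕ} (S : (t : ℕ) → (Fin t → Ω₁) → Fin d → ℝ) (t : ℕ) (ω : Fin t → Ω₁)
    (x : Ω₁) : Fin d → ℝ :=
  fun i => S (t + 1) (Fin.snoc ω x) i - S t ω i

/-- The one-step martingale measures `𝒬_t(ω)` dominated by `𝒫_t(ω)`. -/
def Q1fam {d : ℕ} (Pt : (t : ℕ) → (Fin t → Ω₁) → Set (ProbabilityMeasure Ω₁))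
    (S : (t : ℕ) → (Fin t → Ω₁) → Fin d → ℝ) (t : ℕ) (ω : Fin t → Ω₁) :
    Set (ProbabilityMeasure Ω₁) :=
  {Q | (∃ P' ∈ Pt t ω, (Q : Measure Ω₁) ≪ (P' : Measure Ω₁)) ∧
    ∀ i, expec (Q : Measure Ω₁) (fun x => incr Ω₁ S t ω x i) = 0}

/-- `V` is a `Q`-supermartingale with respect to the filtration `(ℱ_t)`:
each `V_t` is `Q`-integrable and `E_Q[V_{t+1} | ℱ_t] ≤ V_t`. -/
def IsSupermart {T : ℕ} (V : ℕ → (Fin T → Ω₁) → ℝ) (Q : Measure (Fin T → Ω₁)) : Prop :=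
  (∀ t : ℕ, t ≤ T → Integrable (V t) Q) ∧
  ∀ (t : ℕ) (h : t + 1 ≤ T) (A : Set (Fin T → Ω₁)),
    MeasurableSet[filtr Ω₁ T t ((Nat.le_succ t).trans h)] A →
      ∫ ω in A, V (t + 1) ω ∂Q ≤ ∫ ω in A, V t ω ∂Q

end Polish

/-! ### Quasi-sure supports -/

/-- The quasi-sure support of a family of measures on `ℝ^d`. -/
def qsSupp {d : ℕ} (Rs : Set (Measure (Fin d → ℝ))) : Set (Fin d → ℝ) :=
  ⋂₀ {A : Set (Fin d → ℝ) | IsClosed A ∧ ∀ R ∈ Rs, R A = 1}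

end BN

namespace BN

section Closedness

variable {Ω ι : Type*}

/-- The filter of properties holding `PP`-quasi surely. -/
def qsFilter [m : MeasurableSpace Ω] (PP : Set (Measure Ω)) : Filter Ω :=
  Filter.ofCountableInter {s | IsPolar PP m sᶜ}
    (by
      intro C hC hsub
      have hsub' : ∀ s ∈ C, IsPolar PP m sᶜ := fun s hs => hsub hs
      choose! A hA hCA hPA using hsub'
      refine ⟨⋃ s ∈ C, A s, .biUnion hC hA, ?_, fun P hP => ?_⟩
      · intro ω hω
        simp only [mem_compl_iff, mem_sInter, not_forall] at hω
        obtain ⟨s, hs, hωs⟩ := hω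
        exact mem_biUnion hs (hCA s hs hωs)
      · exact (measure_biUnion_null_iff hC).2 fun s hs => hPA s hs P hP)
    (by
      rintro s t ⟨A, hA, hsA, hPA⟩ hst
      exact ⟨A, hA, (compl_subset_compl.2 hst).trans hsA, hPA⟩)

instance [MeasurableSpace Ω] (PP : Set (Measure Ω)) : CountableInterFilter (qsFilter PP) :=
  Filter.countableInter_ofCountableInter _ _ _

lemma eventually_qsFilter [m : MeasurableSpace Ω] {PP : Set (Measure Ω)} {p : Ω → Prop} :
    (∀ᶠ ω in qsFilter PP, p ω) ↔ QuasiSure PP m p :=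
  Iff.rfl

lemma qsFilter_neBot [MeasurableSpace Ω] {PP : Set (Measure Ω)} (hne : PP.Nonempty)
    (hprob : ∀ P ∈ PP, IsProbabilityMeasure P) : (qsFilter PP).NeBot := by
  rw [← Filter.empty_mem_iff_bot.not.trans Filter.neBot_iff.symm]
  rintro ⟨A, -, hA, hPA⟩
  obtain ⟨P, hP⟩ := hne
  have := hprob P hP
  have hAuniv : A = univ := by simpa using hA
  simpa [hAuniv] using hPA P hP

/-- Dominating approximations `w n → wlim` by elements of `G` up to `l`-negligible sets is enough
to dominate the limit `wlim`. -/
def DominationClosed (l : Filter Ω) (G : Set (Ω → ℝ)) : Prop :=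
  ∀ (g w : ℕ → Ω → ℝ) (wlim : Ω → ℝ), (∀ n, g n ∈ G) → (∀ n, ∀ᶠ ω in l, w n ω ≤ g n ω) →
    (∀ ω, Tendsto (fun n => w n ω) atTop (𝓝 (wlim ω))) → ∃ k ∈ G, ∀ᶠ ω in l, wlim ω ≤ k ω

/-- `G` is a module over the `E`-measurable functions which is stable under selecting one of
countably many elements in an `E`-measurable way. -/
structure IsStableModule (E : MeasurableSpace Ω) (G : Set (Ω → ℝ)) : Prop where
  add : ∀ g ∈ G, ∀ g' ∈ G, (fun ω => g ω + g' ω) ∈ G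
  mul : ∀ a : Ω → ℝ, Measurable[E] a → ∀ g ∈ G, (fun ω => a ω * g ω) ∈ G
  select : ∀ τ : Ω → ℕ, Measurable[E] τ → ∀ g : ℕ → Ω → ℝ, (∀ n, g n ∈ G) →
    (fun ω => g (τ ω) ω) ∈ G

lemma measurable_select {β : Type*} [MeasurableSpace β] {E : MeasurableSpace Ω} {τ : Ω → ℕ}
    (hτ : Measurable[E] τ) {g : ℕ → Ω → β} (hg : ∀ n, Measurable[E] (g n)) :
    Measurable[E] fun ω => g (τ ω) ω :=
  (measurable_from_prod_countable_right (f := fun p : ℕ × Ω => g p.1 p.2) hg).comp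
    (hτ.prodMk measurable_id)

/-- A bounded sequence of random variables has a measurable random subsequence that converges
pointwise. -/
lemma exists_measurable_subseq {E : MeasurableSpace Ω} {φ : ℕ → Ω → ℝ}
    (hφ : ∀ n, Measurable[E] (φ n)) {C : ℝ} (hC : ∀ n ω, |φ n ω| ≤ C) :
    ∃ (L : Ω → ℝ) (τ : ℕ → Ω → ℕ), Measurable[E] L ∧ (∀ n, Measurable[E] (τ n)) ∧
      (∀ n ω, n ≤ τ n ω) ∧ ∀ ω, Tendsto (fun n => φ (τ n ω) ω) atTop (𝓝 (L ω)) := by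
  classical
  set L : Ω → ℝ := fun ω => liminf (fun n => φ n ω) atTop with hL
  have hLm : Measurable[E] L := Measurable.liminf hφ
  have hbelow (ω) : IsBoundedUnder (· ≥ ·) atTop fun n => φ n ω :=
    isBoundedUnder_of ⟨-C, fun n => (abs_le.1 (hC n ω)).1⟩
  have habove (ω) : IsBoundedUnder (· ≤ ·) atTop fun n => φ n ω :=
    isBoundedUnder_of ⟨C, fun n => (abs_le.1 (hC n ω)).2⟩
  have hex (n : ℕ) (ω : Ω) : ∃ k, n ≤ k ∧ |φ k ω - L ω| < 1 / ((n : ℝ) + 1) := by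
    have hpos : (0 : ℝ) < 1 / ((n : ℝ) + 1) := by positivity
    have hlt : ∀ᶠ k in atTop, L ω - 1 / ((n : ℝ) + 1) < φ k ω :=
      eventually_lt_of_lt_liminf (by linarith) (hbelow ω)
    have hgt : ∃ᶠ k in atTop, φ k ω < L ω + 1 / ((n : ℝ) + 1) :=
      frequently_lt_of_liminf_lt (habove ω).isCoboundedUnder_ge (by linarith)
    obtain ⟨k, h₁, h₂, h₃⟩ := (hgt.and_eventually (hlt.and (eventually_ge_atTop n))).exists
    exact ⟨k, h₃, abs_sub_lt_iff.2 ⟨by linarith, by linarith⟩⟩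
  refine ⟨L, fun n ω => Nat.find (hex n ω), hLm, fun n => ?_,
    fun n ω => (Nat.find_spec (hex n ω)).1, fun ω => ?_⟩
  · refine measurable_find (hex n) fun k => ?_
    have hm : Measurable[E] fun ω => |φ k ω - L ω| := ((hφ k).sub hLm).abs
    exact (MeasurableSet.const _).inter (measurableSet_lt hm measurable_const)
  · rw [tendsto_iff_dist_tendsto_zero]
    exact squeeze_zero (fun _ => dist_nonneg)
      (fun n => (Nat.find_spec (hex n ω)).2.le) tendsto_one_div_add_atTop_nhds_zero_nat

/-- Adding one further traded direction `x`, held in `E`-measurable amounts, to a closed module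
preserves closedness, provided that no arbitrage arises. -/
lemma DominationClosed.add_direction {l : Filter Ω} [CountableInterFilter l]
    {E : MeasurableSpace Ω} {G : Set (Ω → ℝ)} (hG : DominationClosed l G)
    (hE : IsStableModule E G) (x : Ω → ℝ)
    (hNA : ∀ h : Ω → ℝ, Measurable[E] h → ∀ g ∈ G,
      (∀ᶠ ω in l, 0 ≤ h ω * x ω + g ω) → ∀ᶠ ω in l, h ω * x ω + g ω = 0) :
    DominationClosed l
      {W | ∃ h : Ω → ℝ, Measurable[E] h ∧ ∃ g ∈ G, W = fun ω => h ω * x ω + g ω} := by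
  intro W w w' hW hle hlim
  choose h hh g hg hWeq using hW
  have hle' : ∀ᶠ ω in l, ∀ n, w n ω ≤ h n ω * x ω + g n ω :=
    eventually_countable_forall.2 fun n => by simpa [hWeq n] using hle n
  have hpos (n ω) : 0 < 1 + |h n ω| := by positivity
  -- Normalise the positions so that a random subsequence converges.
  set φ : ℕ → Ω → ℝ := fun n ω => h n ω / (1 + |h n ω|) with hφ
  have hφm (n) : Measurable[E] (φ n) := (hh n).div (measurable_const.add (hh n).abs)
  have hφabs (n ω) : 1 - |φ n ω| = (1 + |h n ω|)⁻¹ := by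
    have := hpos n ω
    simp only [hφ, abs_div, abs_of_pos this]
    field_simp
    ring
  have hφle (n ω) : |φ n ω| ≤ 1 := by
    have : 0 < (1 + |h n ω|)⁻¹ := inv_pos.2 (hpos n ω)
    linarith [hφabs n ω]
  obtain ⟨L, τ, hL, hτ, hτn, hLlim⟩ := exists_measurable_subseq hφm hφle
  have hLle (ω) : |L ω| ≤ 1 := le_of_tendsto' (hLlim ω).abs fun n => hφle _ ω
  obtain ⟨k, hk, hkle⟩ := hG
    (fun n ω => (1 - |φ (τ n ω) ω|) * g (τ n ω) ω)
    (fun n ω => (1 - |φ (τ n ω) ω|) * w (τ n ω) ω - φ (τ n ω) ω * x ω)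
    (fun ω => (1 - |L ω|) * w' ω - L ω * x ω)
    (fun n => hE.mul _ (measurable_const.sub (measurable_select (hτ n) hφm).abs) _
      (hE.select _ (hτ n) _ hg))
    (fun n => by
      filter_upwards [hle'] with ω hω
      have h₁ := hω (τ n ω)
      have h₂ : φ (τ n ω) ω = (1 - |φ (τ n ω) ω|) * h (τ n ω) ω := by
        rw [hφabs, ← div_eq_inv_mul]
      have h₃ : 0 ≤ 1 - |φ (τ n ω) ω| := by linarith [hφle (τ n ω) ω]
      have h₄ := mul_le_mul_of_nonneg_left h₁ h₃
      have h₅ := congrArg (· * x ω) h₂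
      linarith)
    (fun ω => ((tendsto_const_nhds.sub (hLlim ω).abs).mul
      ((hlim ω).comp (tendsto_atTop_mono (fun n => hτn n ω) tendsto_id))).sub
      ((hLlim ω).mul_const _))
  -- Where `|L| = 1`, the direction `x` is replicated by an element of `G`.
  set b : Ω → ℝ := {ω | |L ω| = 1}.indicator 1 with hb
  have hbm : Measurable[E] b :=
    measurable_one.indicator (hL.abs (measurableSet_singleton 1))
  have hb1 {ω} (hω : |L ω| = 1) : b ω = 1 := by simp [hb, hω]
  have hb0 {ω} (hω : |L ω| ≠ 1) : b ω = 0 := by simp [hb, hω]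
  have hrep : ∀ᶠ ω in l, b ω * L ω * x ω + b ω * k ω = 0 := by
    refine hNA (fun ω => b ω * L ω) (hbm.mul hL) _ (hE.mul b hbm k hk) ?_
    filter_upwards [hkle] with ω hω
    by_cases h1 : |L ω| = 1
    · rw [hb1 h1]
      rw [h1] at hω
      linarith
    · simp [hb0 h1]
  obtain ⟨q, hq, hqle⟩ := hG
    (fun n ω => b ω * (g n ω + -(h n ω * L ω) * k ω)) (fun n ω => b ω * w n ω)
    (fun ω => b ω * w' ω)
    (fun n => hE.mul b hbm _ (hE.add _ (hg n) _ (hE.mul _ ((hh n).mul hL).neg k hk)))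
    (fun n => by
      filter_upwards [hle', hrep] with ω hω hr
      by_cases h1 : |L ω| = 1
      · rw [hb1 h1] at hr ⊢
        have hsq : L ω * L ω = 1 := by rw [← abs_mul_abs_self, h1, one_mul]
        have hx : x ω = -(L ω * k ω) := by linear_combination L ω * hr - x ω * hsq
        have := hω n
        rw [hx] at this
        linarith
      · simp [hb0 h1])
    (fun ω => (hlim ω).const_mul _)
  refine ⟨_, ⟨fun ω => (1 - |L ω|)⁻¹ * L ω, (measurable_const.sub hL.abs).inv.mul hL, _,
    hE.add _ (hE.mul (fun ω => (1 - |L ω|)⁻¹) (measurable_const.sub hL.abs).inv k hk) _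
      (hE.mul b hbm q hq), rfl⟩, ?_⟩
  filter_upwards [hkle, hqle] with ω h₁ h₂
  by_cases h1 : |L ω| = 1
  · simpa [hb1 h1, h1] using h₂
  · have hp : 0 < 1 - |L ω| := by
      have := lt_of_le_of_ne (hLle ω) h1
      linarith
    rw [hb0 h1]
    have h₃ : (1 - |L ω|) * w' ω ≤ L ω * x ω + k ω := by linarith
    rw [← le_inv_mul_iff₀ hp] at h₃
    linarith

/-- The final gains from trading the directions `x i`, `i ∈ s`, in `F i`-measurable amounts. -/
def tradingSpan (F : ι → MeasurableSpace Ω) (x : ι → Ω → ℝ) (s : Finset ι) : Set (Ω → ℝ) :=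
  {g | ∃ h : ι → Ω → ℝ, (∀ i ∈ s, Measurable[F i] (h i)) ∧ g = fun ω => ∑ i ∈ s, h i ω * x i ω}

lemma tradingSpan_isStableModule {F : ι → MeasurableSpace Ω} {x : ι → Ω → ℝ} {s : Finset ι}
    {E : MeasurableSpace Ω} (hE : ∀ i ∈ s, E ≤ F i) : IsStableModule E (tradingSpan F x s) where
  add := by
    rintro _ ⟨h, hh, rfl⟩ _ ⟨h', hh', rfl⟩
    refine ⟨fun i ω => h i ω + h' i ω, fun i hi => (hh i hi).add (hh' i hi), ?_⟩
    simp only [add_mul, Finset.sum_add_distrib]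
  mul := by
    rintro a ha _ ⟨h, hh, rfl⟩
    refine ⟨fun i ω => a ω * h i ω, fun i hi => (ha.mono (hE i hi) le_rfl).mul (hh i hi), ?_⟩
    simp only [Finset.mul_sum, mul_assoc]
  select := by
    intro τ hτ g hg
    choose h hh hgeq using hg
    refine ⟨fun i ω => h (τ ω) i ω, fun i hi => ?_, by simp only [hgeq]⟩
    exact measurable_select (hτ.mono (hE i hi) le_rfl) fun n => hh n i hi

lemma tradingSpan_insert [DecidableEq ι] {F : ι → MeasurableSpace Ω} {x : ι → Ω → ℝ}
    {s : Finset ι} {a : ι} (ha : a ∉ s) :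
    tradingSpan F x (insert a s) =
      {W | ∃ h : Ω → ℝ, Measurable[F a] h ∧ ∃ g ∈ tradingSpan F x s,
        W = fun ω => h ω * x a ω + g ω} := by
  ext W
  constructor
  · rintro ⟨h, hh, rfl⟩
    refine ⟨h a, hh a (Finset.mem_insert_self a s), _,
      ⟨h, fun i hi => hh i (Finset.mem_insert_of_mem hi), rfl⟩, ?_⟩
    simp only [Finset.sum_insert ha]
  · rintro ⟨h₀, hh₀, _, ⟨h, hh, rfl⟩, rfl⟩
    have hne {i} (hi : i ∈ s) : i ≠ a := fun hia => ha (hia ▸ hi)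
    refine ⟨Function.update h a h₀, fun i hi => ?_, ?_⟩
    · obtain rfl | hi := Finset.mem_insert.1 hi
      · simpa using hh₀
      · simpa [hne hi] using hh i hi
    · funext ω
      rw [Finset.sum_insert ha, Function.update_self]
      congr 1
      exact Finset.sum_congr rfl fun i hi => by rw [Function.update_of_ne (hne hi)]

lemma tradingSpan_mono {F : ι → MeasurableSpace Ω} {x : ι → Ω → ℝ} {s t : Finset ι}
    (hst : s ⊆ t) : tradingSpan F x s ⊆ tradingSpan F x t := by
  classical
  rintro _ ⟨h, hh, rfl⟩
  refine ⟨fun i => if i ∈ s then h i else 0, fun i _ => ?_, ?_⟩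
  · by_cases hi : i ∈ s
    · simpa [hi] using hh i hi
    · simp only [if_neg hi]
      exact @measurable_const ℝ Ω _ (F i) 0
  · funext ω
    rw [← Finset.sum_subset hst fun i _ hi => by simp [hi]]
    exact Finset.sum_congr rfl fun i hi => by simp [hi]

/-- Under no arbitrage, the set of attainable gains is closed for domination. -/
lemma tradingSpan_dominationClosed {l : Filter Ω} [CountableInterFilter l] {α : Type*}
    [LinearOrder α] {F : α → MeasurableSpace Ω} (hF : Monotone F) (time : ι → α)
    {x : ι → Ω → ℝ} (s : Finset ι)
    (hNA : ∀ g ∈ tradingSpan (F ∘ time) x s, (∀ᶠ ω in l, 0 ≤ g ω) → ∀ᶠ ω in l, g ω = 0) :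
    DominationClosed l (tradingSpan (F ∘ time) x s) := by
  classical
  induction s using Finset.induction_on_min_value time with
  | empty =>
    intro g w w' hg hle hlim
    refine ⟨fun _ => 0, ⟨0, by simp, by simp⟩, ?_⟩
    filter_upwards [eventually_countable_forall.2 hle] with ω hω
    refine le_of_tendsto' (hlim ω) fun n => ?_
    obtain ⟨h, -, hgn⟩ := hg n
    simpa [hgn] using hω n
  | insert a s ha hmin ih =>
    have hclosed := ih fun g hg => hNA g (tradingSpan_mono (Finset.subset_insert a s) hg)
    rw [tradingSpan_insert ha] at hNA ⊢
    exact hclosed.add_direction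
      (tradingSpan_isStableModule fun i hi => hF (hmin i hi)) (x a)
      fun h hh g hg => hNA _ ⟨h, hh, g, hg, rfl⟩

end Closedness

/-- The gains of predictable strategies are the gains from trading all price increments. -/
lemma mem_tradingSpan_increments_iff {Ω : Type*} [MeasurableSpace Ω]
    {F : ℕ → MeasurableSpace Ω} {T d : ℕ} {S : ℕ → Ω → Fin d → ℝ} {g : Ω → ℝ} :
    g ∈ tradingSpan (F ∘ fun p : Fin T × Fin d => (p.1 : ℕ))
        (fun p ω => S (p.1 + 1) ω p.2 - S p.1 ω p.2) Finset.univ ↔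
      ∃ H : ℕ → Ω → Fin d → ℝ, PredictableF F T d H ∧ g = gainF S H T := by
  constructor
  · rintro ⟨h, hh, rfl⟩
    refine ⟨fun n ω i => if hn : n - 1 < T then h (⟨n - 1, hn⟩, i) ω else 0, fun u hu => ?_, ?_⟩
    · rw [@measurable_pi_iff]
      intro i
      simpa [hu] using hh (⟨u, hu⟩, i) (Finset.mem_univ _)
    · funext ω
      simp [gainF, Fintype.sum_prod_type]
  · rintro ⟨H, hH, rfl⟩
    refine ⟨fun p ω => H (p.1 + 1) ω p.2, fun p _ => ?_, ?_⟩
    · exact (measurable_pi_apply p.2).comp (hH p.1 p.1.2)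
    · funext ω
      simp [gainF, Fintype.sum_prod_type]

end BN

open BN in
/-- **Existence of optimal superhedging strategies** (Theorem 2.2). Under `NA(𝒫)`,
for any random variable `f`, the superhedging price `π(f)` is `> -∞` and there is a
predictable `H` with `π(f) + (H·S)_T ≥ f` `𝒫`-q.s. (the inequality being read in
the extended reals, so that it is trivial when `π(f) = +∞`). -/
theorem optimal_superhedging_strategy_exists
    (Ω : Type) [m : MeasurableSpace Ω] (T d : ℕ)
    (F : ℕ → MeasurableSpace Ω) (hFmono : ∀ t, F t ≤ F (t + 1)) (hFle : ∀ t, F t ≤ m)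
    (PP : Set (Measure Ω)) (hne : PP.Nonempty) (hprob : ∀ P ∈ PP, IsProbabilityMeasure P)
    (S : ℕ → Ω → Fin d → ℝ) (hS : ∀ t, t ≤ T → Measurable (S t))
    (hNA : NAF F T d S PP)
    (f : Ω → ℝ) (hf : Measurable f) :
    superPriceF F T d S PP f ≠ ⊥ ∧
    ∃ H : ℕ → Ω → Fin d → ℝ, PredictableF F T d H ∧
      QuasiSure PP m (fun ω =>
        (f ω : EReal) ≤ superPriceF F T d S PP f + ((gainF S H T ω : ℝ) : EReal)) := by
  have : (qsFilter PP).NeBot := qsFilter_neBot hne hprob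
  have hclosed := tradingSpan_dominationClosed (l := qsFilter PP) (monotone_nat_of_le_succ hFmono)
    (fun p : Fin T × Fin d => (p.1 : ℕ))
    (x := fun p ω => S (p.1 + 1) ω p.2 - S p.1 ω p.2) Finset.univ (by
      intro g hg hg0
      obtain ⟨H, hH, rfl⟩ := mem_tradingSpan_increments_iff.1 hg
      exact hNA H hH hg0)
  set X : Set ℝ := {x : ℝ | ∃ H : ℕ → Ω → Fin d → ℝ, PredictableF F T d H ∧
    QuasiSure PP m (fun ω => f ω ≤ x + gainF S H T ω)} with hX
  have hprice : superPriceF F T d S PP f = sInf ((fun x : ℝ => (x : EReal)) '' X) := rfl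
  have hhedge (c : ℕ → ℝ) (hc : ∀ n, superPriceF F T d S PP f < (c n : EReal)) (w : ℕ → Ω → ℝ)
      (w' : Ω → ℝ) (hw : ∀ n ω, w n ω ≤ f ω - c n)
      (hlim : ∀ ω, Tendsto (fun n => w n ω) atTop (𝓝 (w' ω))) :
      ∃ H : ℕ → Ω → Fin d → ℝ, PredictableF F T d H ∧
        ∀ᶠ ω in qsFilter PP, w' ω ≤ gainF S H T ω := by
    have hex (n : ℕ) : ∃ H : ℕ → Ω → Fin d → ℝ, PredictableF F T d H ∧
        ∀ᶠ ω in qsFilter PP, w n ω ≤ gainF S H T ω := by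
      obtain ⟨_, ⟨x, ⟨H, hH, hHf⟩, rfl⟩, hx⟩ := sInf_lt_iff.1 (hprice ▸ hc n)
      have hx' : x < c n := EReal.coe_lt_coe_iff.1 hx
      refine ⟨H, hH, ?_⟩
      filter_upwards [eventually_qsFilter.2 hHf] with ω hω
      linarith [hw n ω]
    choose H hH hHw using hex
    obtain ⟨g, hg, hgw⟩ := hclosed (fun n => gainF S (H n) T) w w'
      (fun n => mem_tradingSpan_increments_iff.2 ⟨H n, hH n, rfl⟩) hHw hlim
    obtain ⟨H', hH', rfl⟩ := mem_tradingSpan_increments_iff.1 hg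
    exact ⟨H', hH', hgw⟩
  have hbot : superPriceF F T d S PP f ≠ ⊥ := by
    intro hbot
    obtain ⟨H, hH, hH1⟩ := hhedge (fun n => -(n : ℝ)) (fun n => hbot ▸ EReal.bot_lt_coe _)
      (fun n ω => min (f ω + n) 1) (fun _ => 1)
      (fun n ω => (min_le_left _ _).trans (by linarith))
      (fun ω => tendsto_const_nhds.congr' <| by
        obtain ⟨N, hN⟩ := exists_nat_ge (1 - f ω)
        filter_upwards [eventually_ge_atTop N] with n hn
        have : (N : ℝ) ≤ n := Nat.cast_le.2 hn
        exact (min_eq_right (by linarith)).symm)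
    have hzero : ∀ᶠ ω in qsFilter PP, gainF S H T ω = 0 :=
      hNA H hH (hH1.mono fun ω hω => zero_le_one.trans hω)
    obtain ⟨ω, h₁, h₂⟩ := (hH1.and hzero).exists
    linarith
  refine ⟨hbot, ?_⟩
  generalize hp : superPriceF F T d S PP f = p at hbot hhedge ⊢
  induction p with
  | bot => exact absurd rfl hbot
  | top =>
    refine ⟨fun _ _ _ => 0, fun _ _ => measurable_const, eventually_qsFilter.1 ?_⟩
    exact Eventually.of_forall fun ω => by simp
  | coe p =>
    obtain ⟨H, hH, hHf⟩ := hhedge (fun n => p + 1 / ((n : ℝ) + 1))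
      (fun n => EReal.coe_lt_coe_iff.2 (by
        have : (0 : ℝ) < 1 / ((n : ℝ) + 1) := by positivity
        linarith))
      (fun n ω => f ω - (p + 1 / ((n : ℝ) + 1))) (fun ω => f ω - p) (fun _ _ => le_rfl)
      (fun ω => by
        simpa using tendsto_const_nhds.sub
          (tendsto_const_nhds.add (tendsto_one_div_add_atTop_nhds_zero_nat (𝕜 := ℝ))))
    refine ⟨H, hH, eventually_qsFilter.1 ?_⟩
    filter_upwards [hHf] with ω hω
    rw [← EReal.coe_add, EReal.coe_le_coe_iff]
    linarith
end
end

section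
/- One-period Superhedging Theorem (Theorem 3.5): Assume NA(𝒫) holds in the one-period market and let f be a random variable. Then sup_{Q∈𝒬} E_Q[f] = π(f) := inf{x ∈ ℝ : ∃H ∈ ℝ^d with x + H·ΔS ≥ f 𝒫-q.s.}. Moreover π(f) > −∞, and there exists H ∈ ℝ^d such that π(f) + H·ΔS ≥ f 𝒫-q.s. (when π(f) < ∞). -/
open MeasureTheory Set Filter Topology
open scoped ENNReal NNReal

noncomputable section

/-- Proper separation of a point from a convex set in finite dimension. -/
theorem Convex.exists_nonneg_pos_of_zero_notMem {E : Type*} [NormedAddCommGroup E]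
    [NormedSpace ℝ E] [FiniteDimensional ℝ E] {K : Set E} (hK : Convex ℝ K)
    (hne : K.Nonempty) (h0 : (0 : E) ∉ K) :
    ∃ φ : E →ₗ[ℝ] ℝ, (∀ k ∈ K, 0 ≤ φ k) ∧ ∃ k ∈ K, 0 < φ k := by
  by_contra! hcon
  have hvanish (φ : E →ₗ[ℝ] ℝ) (hφ : ∀ k ∈ K, 0 ≤ φ k) (k : E) (hk : k ∈ K) : φ k = 0 :=
    le_antisymm (hcon φ hφ k hk) (hφ k hk)
  let V := Submodule.span ℝ K
  let K' : Set V := (↑) ⁻¹' K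
  have hsub : K ⊆ V := Submodule.subset_span
  have hK' : Convex ℝ K' := hK.linear_preimage V.subtype
  obtain ⟨k₀, hk₀⟩ := hne
  have hne' : K'.Nonempty := ⟨⟨k₀, hsub hk₀⟩, hk₀⟩
  have hvanish' (φ : V →ₗ[ℝ] ℝ) (hφ : ∀ k ∈ K', 0 ≤ φ k) : φ = 0 := by
    obtain ⟨ψ, hψ⟩ := LinearMap.exists_extend φ
    have hφψ (v : V) : φ v = ψ v := by rw [← hψ]; rfl
    have hzero := hvanish ψ fun k hk => by
      simpa [hφψ] using hφ ⟨k, hsub hk⟩ hk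
    have hle : V ≤ LinearMap.ker ψ := Submodule.span_le.2 hzero
    ext v
    rw [hφψ]
    exact hle v.2
  have hint : (interior K').Nonempty := by
    rw [hK'.interior_nonempty_iff_affineSpan_eq_top,
      AffineSubspace.affineSpan_eq_top_iff_vectorSpan_eq_top_of_nonempty ℝ V V hne']
    by_contra hlt
    obtain ⟨φ, hφ0, hφ⟩ := Submodule.exists_le_ker_of_lt_top _ (lt_top_iff_ne_top.2 hlt)
    obtain ⟨v₀, hv₀⟩ := hne'
    have hconst (v : V) (hv : v ∈ K') : φ v = φ v₀ := by
      have := hφ (vsub_mem_vectorSpan ℝ hv hv₀)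
      simpa [sub_eq_zero] using this
    rcases le_total 0 (φ v₀) with h | h
    · exact hφ0 (hvanish' φ fun v hv => (hconst v hv).symm ▸ h)
    · refine hφ0 (neg_eq_zero.1 (hvanish' (-φ) fun v hv => ?_))
      rw [LinearMap.neg_apply, hconst v hv]
      linarith
  obtain ⟨φ, hφ⟩ := geometric_hahn_banach_open_point hK'.interior isOpen_interior
    (fun h => h0 (interior_subset h : (0 : V) ∈ K'))
  rw [map_zero] at hφ
  have hle (v : V) (hv : v ∈ K') : φ v ≤ 0 := by
    have hcl : v ∈ closure (interior K') := by
      rw [hK'.closure_interior_eq_closure_of_nonempty_interior hint]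
      exact subset_closure hv
    exact closure_minimal (fun w hw => (hφ w hw).le)
      (isClosed_le φ.continuous continuous_const) hcl
  have hzero := hvanish' (-φ.toLinearMap) fun v hv => by simpa using hle v hv
  obtain ⟨v, hv⟩ := hint
  have h1 := hφ v hv
  have h2 := LinearMap.congr_fun hzero v
  simp only [LinearMap.neg_apply, ContinuousLinearMap.coe_coe, LinearMap.zero_apply] at h2
  linarith

/-- If no linear functional is nonnegative and nontrivial on the projection of the convex set `M`
to the first factor, then `M` meets the vertical line over the origin. -/
theorem Convex.exists_zero_mk_mem {F : Type*} [NormedAddCommGroup F] [NormedSpace ℝ F]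
    [FiniteDimensional ℝ F] {M : Set (F × ℝ)} (hM : Convex ℝ M) (hne : M.Nonempty)
    (hNA : ∀ φ : F →ₗ[ℝ] ℝ, (∀ p ∈ M, 0 ≤ φ p.1) → ∀ p ∈ M, φ p.1 = 0) :
    ∃ v : ℝ, ((0 : F), v) ∈ M := by
  by_contra! hcon
  obtain ⟨φ, hφ, k, ⟨p, hp, rfl⟩, hpos⟩ :=
    (hM.linear_image (LinearMap.fst ℝ F ℝ)).exists_nonneg_pos_of_zero_notMem (hne.image _) (by
      rintro ⟨⟨m, v⟩, hp, h⟩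
      obtain rfl : m = 0 := h
      exact hcon v hp)
  exact hpos.ne' (hNA φ (fun q hq => hφ _ ⟨q, hq, rfl⟩) p hp)

/-- Under the same condition, an upper bound for `M` on the vertical line over the origin extends
to a supporting affine function dominating all of `M`. -/
theorem Convex.exists_affine_bound {F : Type*} [NormedAddCommGroup F] [NormedSpace ℝ F]
    [FiniteDimensional ℝ F] {M : Set (F × ℝ)} (hM : Convex ℝ M) (hne : M.Nonempty)
    (hNA : ∀ φ : F →ₗ[ℝ] ℝ, (∀ p ∈ M, 0 ≤ φ p.1) → ∀ p ∈ M, φ p.1 = 0)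
    {x : ℝ} (hx : ∀ v : ℝ, ((0 : F), v) ∈ M → v ≤ x) :
    ∃ h : F →ₗ[ℝ] ℝ, ∀ p ∈ M, p.2 ≤ x + h p.1 := by
  let K : Set (F × ℝ) := {q | ∃ p ∈ M, p.1 = q.1 ∧ q.2 + x < p.2}
  have hK : Convex ℝ K := by
    rintro q ⟨p, hp, hpq, hlt⟩ q' ⟨p', hp', hpq', hlt'⟩ a b ha hb hab
    refine ⟨a • p + b • p', hM hp hp' ha hb hab, by simp [hpq, hpq'], ?_⟩
    simp only [Prod.snd_add, Prod.smul_snd, smul_eq_mul]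
    obtain rfl : b = 1 - a := by linarith
    rcases ha.eq_or_lt with rfl | ha
    · simpa using hlt'
    · nlinarith [mul_lt_mul_of_pos_left hlt ha, mul_le_mul_of_nonneg_left hlt'.le hb]
  obtain ⟨p₀, hp₀⟩ := hne
  have hmem (p : F × ℝ) (hp : p ∈ M) (t : ℝ) (ht : 0 < t) : (p.1, p.2 - x - t) ∈ K :=
    ⟨p, hp, rfl, by simp only; linarith⟩
  obtain ⟨φ, hφ, k, hk, hpos⟩ := hK.exists_nonneg_pos_of_zero_notMem
    ⟨_, hmem p₀ hp₀ 1 one_pos⟩ (by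
      rintro ⟨⟨m, v⟩, hp, h, hlt⟩
      obtain rfl : m = 0 := h
      have := hx v hp
      simp only [Prod.snd_zero] at hlt
      linarith)
  let h : F →ₗ[ℝ] ℝ := φ ∘ₗ LinearMap.inl ℝ F ℝ
  let a : ℝ := φ (0, 1)
  have hdecomp (m : F) (w : ℝ) : φ (m, w) = h m + w * a := by
    have : ((m, w) : F × ℝ) = (m, 0) + w • (0, 1) := by simp
    rw [this, map_add, map_smul]
    rfl
  have hbound (p : F × ℝ) (hp : p ∈ M) (t : ℝ) (ht : 0 < t) :
      0 ≤ h p.1 + (p.2 - x - t) * a := by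
    rw [← hdecomp]
    exact hφ _ (hmem p hp t ht)
  have ha : a ≤ 0 := by
    by_contra! ha
    have := hbound p₀ hp₀ ((|h p₀.1 + (p₀.2 - x) * a| + 1) / a) (by positivity)
    rw [sub_mul, div_mul_cancel₀ _ ha.ne'] at this
    linarith [le_abs_self (h p₀.1 + (p₀.2 - x) * a)]
  have ha' : a < 0 := by
    refine ha.lt_of_ne fun ha0 => ?_
    have hzero := hNA h fun p hp => by simpa [ha0] using hbound p hp 1 one_pos
    obtain ⟨p, hp, hpk, -⟩ := hk
    have : φ k = 0 := by
      rw [← Prod.mk.eta (p := k), hdecomp, ha0, ← hpk, hzero p hp]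
      simp
    exact hpos.ne' this
  refine ⟨(-a)⁻¹ • h, fun p hp => ?_⟩
  have hlim : 0 ≤ h p.1 + (p.2 - x) * a := by
    refine le_of_forall_pos_le_add fun ε hε => ?_
    have := hbound p hp (ε / -a) (div_pos hε (neg_pos.2 ha'))
    have hcancel : ε / -a * a = -ε := by
      rw [div_neg, neg_mul, div_mul_cancel₀ _ ha'.ne]
    rw [sub_mul, hcancel] at this
    linarith
  have hna : 0 < -a := neg_pos.2 ha'
  rw [LinearMap.smul_apply, smul_eq_mul, ← sub_le_iff_le_add', ← div_eq_inv_mul, le_div_iff₀ hna]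
  linarith

namespace BN

section Expectation

variable {Ω : Type*} [MeasurableSpace Ω] {Q : Measure Ω} {f g : Ω → ℝ}

theorem expec_eq_integral (hf : Integrable f Q) : expec Q f = ((∫ ω, f ω ∂Q : ℝ) : EReal) := by
  have h1 := hf.lintegral_lt_top
  have h2 := hf.neg.lintegral_lt_top
  simp only [Pi.neg_apply] at h2
  rw [expec, integral_eq_lintegral_pos_part_sub_lintegral_neg_part hf, EReal.coe_sub,
    EReal.coe_ennreal_toReal h1.ne, EReal.coe_ennreal_toReal h2.ne]

theorem integrable_of_expec_eq_zero (hf : Measurable f) (h : expec Q f = 0) :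
    Integrable f Q := by
  have hpos : ∫⁻ ω, ENNReal.ofReal (f ω) ∂Q ≠ ⊤ := by
    intro htop
    rw [expec, htop] at h
    generalize ∫⁻ ω, ENNReal.ofReal (-f ω) ∂Q = c at h
    cases c with
    | top => simp at h
    | coe r =>
      change (⊤ : EReal) - ((r : ℝ) : EReal) = 0 at h
      simp at h
  have hneg : ∫⁻ ω, ENNReal.ofReal (-f ω) ∂Q ≠ ⊤ := by
    intro htop
    rw [expec, htop] at h
    simp at h
  refine ⟨hf.aestronglyMeasurable, ?_⟩
  have hsplit (ω : Ω) : ‖f ω‖ₑ = ENNReal.ofReal (f ω) + ENNReal.ofReal (-f ω) := by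
    rw [← ofReal_norm, Real.norm_eq_abs]
    rcases le_total 0 (f ω) with h | h
    · simp [abs_of_nonneg h, ENNReal.ofReal_of_nonpos (neg_nonpos.2 h)]
    · simp [abs_of_nonpos h, ENNReal.ofReal_of_nonpos h]
  rw [HasFiniteIntegral, lintegral_congr hsplit, lintegral_add_left hf.ennreal_ofReal]
  exact ENNReal.add_lt_top.2 ⟨hpos.lt_top, hneg.lt_top⟩

theorem expec_mono (h : ∀ᵐ ω ∂Q, f ω ≤ g ω) : expec Q f ≤ expec Q g := by
  refine EReal.sub_le_sub (EReal.coe_ennreal_le_coe_ennreal_iff.2 (lintegral_mono_ae ?_))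
    (EReal.coe_ennreal_le_coe_ennreal_iff.2 (lintegral_mono_ae ?_))
  · filter_upwards [h] with ω hω using ENNReal.ofReal_le_ofReal hω
  · filter_upwards [h] with ω hω using ENNReal.ofReal_le_ofReal (neg_le_neg hω)

end Expectation

section Barycenters

variable {Ω : Type*} [MeasurableSpace Ω] {PP : Set (Measure Ω)}

theorem QuasiSure.ae {p : Ω → Prop} (h : QuasiSure PP ‹_› p) {P Q : Measure Ω} (hP : P ∈ PP)
    (hQ : Q ≪ P) : ∀ᵐ ω ∂Q, p ω := by
  obtain ⟨A, -, hA, hnull⟩ := h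
  exact measure_mono_null hA (hQ (hnull P hP))

/-- Every set charged by `P` carries a probability measure dominated by `P` which
integrates `G`. -/
theorem exists_isProbabilityMeasure_integrable {E : Type*} [NormedAddCommGroup E]
    [MeasurableSpace E] [BorelSpace E] [SecondCountableTopology E] {G : Ω → E}
    (hG : Measurable G) {P : Measure Ω} [IsProbabilityMeasure P] {A : Set Ω}
    (hA : MeasurableSet A) (hPA : P A ≠ 0) :
    ∃ ν : Measure Ω, IsProbabilityMeasure ν ∧ ν ≪ P ∧ Integrable G ν ∧ ∀ᵐ ω ∂ν, ω ∈ A := by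
  have hmeas (n : ℕ) : MeasurableSet (A ∩ {ω | ‖G ω‖ ≤ n}) :=
    hA.inter (measurableSet_le hG.norm measurable_const)
  have hunion : A = ⋃ n : ℕ, A ∩ {ω | ‖G ω‖ ≤ n} := by
    rw [← inter_iUnion, eq_comm, inter_eq_left]
    exact fun ω _ => mem_iUnion.2 (exists_nat_ge ‖G ω‖)
  obtain ⟨n, hn⟩ : ∃ n : ℕ, P (A ∩ {ω | ‖G ω‖ ≤ n}) ≠ 0 := by
    by_contra! h
    rw [hunion] at hPA
    exact hPA (measure_iUnion_null h)
  have hprob := ProbabilityTheory.cond_isProbabilityMeasure hn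
  have hmem := ProbabilityTheory.ae_cond_mem (μ := P) (hmeas n)
  refine ⟨_, hprob, ProbabilityTheory.cond_absolutelyContinuous,
    Integrable.of_bound hG.aestronglyMeasurable n (hmem.mono fun ω h => h.2),
    hmem.mono fun ω h => h.1⟩

variable {E : Type*} [NormedAddCommGroup E] [NormedSpace ℝ E]

/-- The expectations of `G` under the probability measures dominated by `PP` which
integrate `G`. -/
def barycenters (PP : Set (Measure Ω)) (G : Ω → E) : Set E :=
  {m | ∃ ν : Measure Ω, IsProbabilityMeasure ν ∧ (∃ P ∈ PP, ν ≪ P) ∧ Integrable G ν ∧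
    ∫ ω, G ω ∂ν = m}

theorem convex_barycenters
    (hconv : ∀ P ∈ PP, ∀ P' ∈ PP, ∀ a b : ℝ≥0∞, a + b = 1 → a • P + b • P' ∈ PP)
    (G : Ω → E) : Convex ℝ (barycenters PP G) := by
  rintro _ ⟨ν, hν, ⟨P, hP, hνP⟩, hint, rfl⟩ _ ⟨ν', hν', ⟨P', hP', hνP'⟩, hint', rfl⟩
    a b ha hb hab
  have hsum : ENNReal.ofReal a + ENNReal.ofReal b = 1 := by
    rw [← ENNReal.ofReal_add ha hb, hab, ENNReal.ofReal_one]
  have hi := hint.smul_measure (ENNReal.ofReal_ne_top (r := a))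
  have hi' := hint'.smul_measure (ENNReal.ofReal_ne_top (r := b))
  refine ⟨ENNReal.ofReal a • ν + ENNReal.ofReal b • ν', ⟨by simpa using hsum⟩,
    ⟨(2 : ℝ≥0∞)⁻¹ • P + (2 : ℝ≥0∞)⁻¹ • P', hconv P hP P' hP' _ _ ENNReal.inv_two_add_inv_two, ?_⟩,
    hi.add_measure hi', ?_⟩
  · intro s hs
    simp only [Measure.add_apply, Measure.smul_apply, smul_eq_mul, add_eq_zero, mul_eq_zero,
      ENNReal.inv_eq_zero, ENNReal.ofNat_ne_top, false_or] at hs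
    simp [hνP hs.1, hνP' hs.2]
  · rw [integral_add_measure hi hi', integral_smul_measure, integral_smul_measure,
      ENNReal.toReal_ofReal ha, ENNReal.toReal_ofReal hb]

variable [MeasurableSpace E] [BorelSpace E] [SecondCountableTopology E] {G : Ω → E}

theorem barycenters_nonempty (hne : PP.Nonempty) (hprob : ∀ P ∈ PP, IsProbabilityMeasure P)
    (hG : Measurable G) : (barycenters PP G).Nonempty := by
  obtain ⟨P, hP⟩ := hne
  have := hprob P hP
  obtain ⟨ν, hν, hνP, hint, -⟩ :=
    exists_isProbabilityMeasure_integrable hG (P := P) MeasurableSet.univ (by simp)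
  exact ⟨_, ν, hν, ⟨P, hP, hνP⟩, hint, rfl⟩

/-- An affine inequality valid for all barycenters of `G` holds quasi-surely for `G`. -/
theorem quasiSure_of_forall_barycenters [CompleteSpace E]
    (hprob : ∀ P ∈ PP, IsProbabilityMeasure P) (hG : Measurable G) (φ : E →L[ℝ] ℝ) (c : ℝ)
    (h : ∀ m ∈ barycenters PP G, φ m ≤ c) :
    QuasiSure PP ‹_› (fun ω => φ (G ω) ≤ c) := by
  have hφG : Measurable fun ω => φ (G ω) := φ.continuous.measurable.comp hG
  have hA : MeasurableSet {ω | ¬ φ (G ω) ≤ c} := (measurableSet_le hφG measurable_const).compl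
  refine ⟨_, hA, Subset.rfl, fun P hP => ?_⟩
  have := hprob P hP
  by_contra hPA
  obtain ⟨ν, hν, hνP, hint, hmem⟩ := exists_isProbabilityMeasure_integrable hG hA hPA
  have hle := h _ ⟨ν, hν, ⟨P, hP, hνP⟩, hint, rfl⟩
  rw [← φ.integral_comp_comm hint] at hle
  have hdiff : Integrable (fun ω => φ (G ω) - c) ν :=
    (φ.integrable_comp hint).sub (integrable_const c)
  have hpos : 0 < ∫ ω, (φ (G ω) - c) ∂ν := by
    rw [integral_pos_iff_support_of_nonneg_ae
      (hmem.mono fun ω hω => by simpa using (not_le.1 hω).le) hdiff]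
    have hsupp : ∀ᵐ ω ∂ν, ω ∈ Function.support fun ω => φ (G ω) - c :=
      hmem.mono fun ω hω => (sub_pos.2 (not_le.1 hω)).ne'
    have hfull := prob_compl_eq_zero_iff₀ (hdiff.1.nullMeasurableSet_support) |>.1 hsupp
    exact hfull ▸ one_pos
  rw [integral_sub (φ.integrable_comp hint) (integrable_const c)] at hpos
  simp only [integral_const, probReal_univ, one_smul] at hpos
  linarith

end Barycenters

section WeakDuality

variable {Ω : Type*} [MeasurableSpace Ω] {PP : Set (Measure Ω)} {d : ℕ} {X : Ω → Fin d → ℝ}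
  {f : Ω → ℝ}

/-- Weak duality: expectations under martingale measures are bounded by the superhedging price. -/
theorem expec_le_superPrice1 (hX : Measurable X) {Q : Measure Ω} (hQ : Q ∈ Q1set PP X) :
    expec Q f ≤ superPrice1 PP X f := by
  obtain ⟨hQprob, ⟨P, hP, hQP⟩, hmart⟩ := hQ
  refine le_sInf ?_
  rintro _ ⟨x, ⟨H, hH⟩, rfl⟩
  have hint (i : Fin d) : Integrable (fun ω => X ω i) Q :=
    integrable_of_expec_eq_zero ((measurable_pi_apply i).comp hX) (hmart i)
  have hzero (i : Fin d) : ∫ ω, X ω i ∂Q = 0 := by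
    have := hmart i
    rw [expec_eq_integral (hint i)] at this
    exact_mod_cast this
  have hgain : Integrable (fun ω => ∑ i, H i * X ω i) Q :=
    integrable_finsetSum _ fun i _ => (hint i).const_mul _
  have hval : ∫ ω, (x + ∑ i, H i * X ω i) ∂Q = x := by
    rw [integral_add (integrable_const x) hgain,
      integral_finsetSum _ fun i _ => (hint i).const_mul _]
    simp [integral_const_mul, hzero]
  have hwealth : Integrable (fun ω => x + ∑ i, H i * X ω i) Q := (integrable_const x).add hgain
  calc expec Q f ≤ expec Q (fun ω => x + ∑ i, H i * X ω i) := expec_mono (hH.ae hP hQP)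
    _ = x := by rw [expec_eq_integral hwealth, hval]

end WeakDuality

end BN

open BN in
/-- **One-period Superhedging Theorem** (Theorem 3.5). Under `NA(𝒫)` in the
one-period market, `sup_{Q ∈ 𝒬} E_Q[f] = π(f)`, `π(f) > -∞`, and there is `H ∈ ℝ^d`
with `π(f) + H·ΔS ≥ f` `𝒫`-q.s. (read in the extended reals, so that the last
claim is trivial when `π(f) = ∞`). -/
theorem one_period_superhedging_theorem
    (Ω : Type) [mΩ : MeasurableSpace Ω]
    (PP : Set (Measure Ω)) (hne : PP.Nonempty)
    (hprob : ∀ P ∈ PP, IsProbabilityMeasure P)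
    (hconv : ∀ P ∈ PP, ∀ P' ∈ PP, ∀ a b : ℝ≥0∞, a + b = 1 → a • P + b • P' ∈ PP)
    (d : ℕ) (S₀ : Fin d → ℝ) (S₁ : Ω → Fin d → ℝ) (hS₁ : Measurable S₁)
    (hNA : NA1 PP (fun ω i => S₁ ω i - S₀ i))
    (f : Ω → ℝ) (hf : Measurable f) :
    sSup ((fun Q => expec Q f) '' Q1set PP (fun ω i => S₁ ω i - S₀ i))
        = superPrice1 PP (fun ω i => S₁ ω i - S₀ i) f ∧
    superPrice1 PP (fun ω i => S₁ ω i - S₀ i) f ≠ ⊥ ∧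
    ∃ H : Fin d → ℝ, QuasiSure PP mΩ (fun ω =>
      (f ω : EReal) ≤ superPrice1 PP (fun ω' i => S₁ ω' i - S₀ i) f
        + ((∑ i, H i * (S₁ ω i - S₀ i) : ℝ) : EReal)) := by
  set X : Ω → Fin d → ℝ := fun ω i => S₁ ω i - S₀ i
  have hX : Measurable X := hS₁.sub_const S₀
  let G : Ω → (Fin d → ℝ) × ℝ := fun ω => (X ω, f ω)
  have hG : Measurable G := hX.prodMk hf
  let M := barycenters PP G
  have hM : Convex ℝ M := convex_barycenters hconv G
  have hMne : M.Nonempty := barycenters_nonempty hne hprob hG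
  have hcoord (φ : (Fin d → ℝ) →ₗ[ℝ] ℝ) (m : Fin d → ℝ) :
      φ m = ∑ i, φ (Pi.single i 1) * m i := by
    rw [LinearMap.pi_apply_eq_sum_univ φ m]
    refine Finset.sum_congr rfl fun i _ => ?_
    rw [smul_eq_mul, mul_comm]
    congr 2
    ext j
    simp [Pi.single_apply, eq_comm]
  have hMNA (φ : (Fin d → ℝ) →ₗ[ℝ] ℝ) (hφ : ∀ p ∈ M, 0 ≤ φ p.1) (p) (hp : p ∈ M) :
      φ p.1 = 0 := by
    let ψ : (Fin d → ℝ) × ℝ →L[ℝ] ℝ :=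
      LinearMap.toContinuousLinearMap φ ∘L ContinuousLinearMap.fst ℝ (Fin d → ℝ) ℝ
    have hqs := quasiSure_of_forall_barycenters hprob hG (-ψ) 0
      (fun m hm => neg_nonpos.2 (hφ m hm))
    have hgain : QuasiSure PP mΩ (fun ω => ∑ i, φ (Pi.single i 1) * X ω i = 0) := by
      refine hNA (fun i => φ (Pi.single i 1)) ?_
      convert hqs using 2 with ω
      rw [← hcoord φ (X ω)]
      exact neg_nonpos.symm
    obtain ⟨ν, hν, ⟨P, hP, hνP⟩, hint, rfl⟩ := hp
    change ψ (∫ ω, G ω ∂ν) = 0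
    rw [← ψ.integral_comp_comm hint]
    refine integral_eq_zero_of_ae ((hgain.ae hP hνP).mono fun ω hω => ?_)
    exact (hcoord φ (X ω)).trans hω
  have hQ (v : ℝ) (hv : ((0 : Fin d → ℝ), v) ∈ M) :
      (v : EReal) ≤ sSup ((fun Q => expec Q f) '' Q1set PP X) := by
    obtain ⟨ν, hν, hdom, hint, hνv⟩ := hv
    have hcoordInt (i : Fin d) : Integrable (fun ω => X ω i) ν := hint.fst.eval i
    have hzero (i : Fin d) : ∫ ω, X ω i ∂ν = 0 := by
      rw [← eval_integral hcoordInt i]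
      have : ∫ ω, X ω ∂ν = 0 := by rw [← fst_integral hint, hνv]
      rw [this, Pi.zero_apply]
    have hfv : ∫ ω, f ω ∂ν = v := by rw [← snd_integral hint, hνv]
    refine le_sSup ⟨ν, ⟨hν, hdom, fun i => ?_⟩, ?_⟩
    · rw [expec_eq_integral (hcoordInt i), hzero, EReal.coe_zero]
    · simp only
      rw [expec_eq_integral hint.snd, hfv]
  have hweak : sSup ((fun Q => expec Q f) '' Q1set PP X) ≤ superPrice1 PP X f := by
    refine sSup_le ?_
    rintro _ ⟨Q, hQ, rfl⟩
    exact expec_le_superPrice1 hX hQ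
  obtain ⟨v₀, hv₀⟩ := hM.exists_zero_mk_mem hMne hMNA
  have hbot : sSup ((fun Q => expec Q f) '' Q1set PP X) ≠ ⊥ := fun h => by
    simpa [h] using hQ v₀ hv₀
  have hbot' : superPrice1 PP X f ≠ ⊥ := fun h => hbot (le_bot_iff.1 (h ▸ hweak))
  by_cases htop : sSup ((fun Q => expec Q f) '' Q1set PP X) = ⊤
  · have hprice : superPrice1 PP X f = ⊤ := top_le_iff.1 (htop ▸ hweak)
    refine ⟨htop.trans hprice.symm, hbot', 0, ∅, MeasurableSet.empty, ?_, by simp⟩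
    intro ω hω
    refine hω ?_
    simp only [hprice, EReal.top_add_coe]
    exact le_top
  · lift sSup ((fun Q => expec Q f) '' Q1set PP X) to ℝ using ⟨htop, hbot⟩ with x hx
    obtain ⟨h, hh⟩ := hM.exists_affine_bound hMne hMNA
      (x := x) (fun v hv => EReal.coe_le_coe_iff.1 (hQ v hv))
    let ψ : (Fin d → ℝ) × ℝ →L[ℝ] ℝ := ContinuousLinearMap.snd ℝ (Fin d → ℝ) ℝ -
      LinearMap.toContinuousLinearMap h ∘L ContinuousLinearMap.fst ℝ (Fin d → ℝ) ℝ
    have hqs := quasiSure_of_forall_barycenters hprob hG ψ x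
      (fun m hm => sub_le_iff_le_add.2 (hh m hm))
    have hhedge : QuasiSure PP mΩ (fun ω => f ω ≤ x + ∑ i, h (Pi.single i 1) * X ω i) := by
      convert hqs using 2 with ω
      rw [← hcoord h (X ω)]
      exact sub_le_iff_le_add.symm
    have hprice : superPrice1 PP X f = x :=
      le_antisymm (sInf_le ⟨x, ⟨_, hhedge⟩, rfl⟩) hweak
    refine ⟨hprice.symm, hbot', fun i => h (Pi.single i 1), ?_⟩
    rw [hprice]
    convert hhedge using 2 with ω
    rw [← EReal.coe_add, EReal.coe_le_coe_iff]
end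
end
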